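/- arXiv:2201.09433 — 8 statements merged into one kernel-verified Lean document; each statement's English description precedes it below -/
import Mathlib

section
/- Let d ≥ 1 be an integer, let f be a real polynomial of degree at most d, and let a < b be real numbers. If sign(f^{(i)}(a)) = sign(f^{(i)}(b)) for every 1 ≤ i ≤ d, then f is monotone on the interval [a,b] (i.e., f is either monotone non-decreasing on [a,b] or monotone non-increasing on [a,b]). -/
/-- sign(t) = 1 if t ≥ 0 and −1 otherwise. -/
noncomputable def sgn (t : ℝ) : ℝ := if 0 ≤ t then 1 else -1

theorem nonneg_iff_of_sgn_eq {s t : ℝ} (h : sgn s = sgn t) : 0 ≤ s ↔ 0 ≤ t := by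
  unfold sgn at h
  split_ifs at h with hs ht ht
  · exact iff_of_true hs ht
  · norm_num at h
  · norm_num at h
  · exact iff_of_false hs ht

theorem monotoneOn_or_antitoneOn_of_sgn_derivative_eq {a b : ℝ} (hab : a ≤ b) (d : ℕ)
    (f : Polynomial ℝ) (hdeg : f.natDegree ≤ d)
    (hsigns : ∀ i, 1 ≤ i → i ≤ d →
      sgn ((Polynomial.derivative^[i] f).eval a) =
        sgn ((Polynomial.derivative^[i] f).eval b)) :
    MonotoneOn (fun x => f.eval x) (Set.Icc a b) ∨
      AntitoneOn (fun x => f.eval x) (Set.Icc a b) := by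
  induction d generalizing f with
  | zero =>
    rw [Polynomial.eq_C_of_natDegree_le_zero hdeg]
    left
    intro x _ y _ _
    simp
  | succ d ih =>
    have hmono := ih f.derivative
      ((Polynomial.natDegree_derivative_le f).trans (by omega)) fun i _ hi => by
        simpa only [Function.iterate_succ_apply] using hsigns (i + 1) (by omega) (by omega)
    have hiff : 0 ≤ f.derivative.eval a ↔ 0 ≤ f.derivative.eval b :=
      nonneg_iff_of_sgn_eq (hsigns 1 le_rfl (by omega))
    have ha : a ∈ Set.Icc a b := Set.left_mem_Icc.2 hab
    have hb : b ∈ Set.Icc a b := Set.right_mem_Icc.2 hab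
    by_cases h : 0 ≤ f.derivative.eval a
    · left
      refine monotoneOn_of_deriv_nonneg (convex_Icc a b) f.continuousOn
        f.differentiable.differentiableOn fun x hx => ?_
      have hx := interior_subset hx
      rw [Polynomial.deriv]
      rcases hmono with hm | hm
      · exact h.trans (hm ha hx hx.1)
      · exact (hiff.1 h).trans (hm hx hb hx.2)
    · right
      refine antitoneOn_of_deriv_nonpos (convex_Icc a b) f.continuousOn
        f.differentiable.differentiableOn fun x hx => ?_
      have hx := interior_subset hx
      rw [Polynomial.deriv]
      rcases hmono with hm | hm
      · exact (hm hx hb hx.2).trans (not_le.1 (mt hiff.2 h)).le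
      · exact (hm ha hx hx.1).trans (not_le.1 h).le

/-- If a polynomial `f` of degree at most `d` has the same derivative sign pattern
(orders `1,…,d`) at `a` and at `b`, then `f` is monotone on `[a,b]`. -/
theorem stmt0 (d : ℕ) (hd : 1 ≤ d) (f : Polynomial ℝ) (hdeg : f.natDegree ≤ d)
    (a b : ℝ) (hab : a < b)
    (hsigns : ∀ i, 1 ≤ i → i ≤ d →
      sgn ((Polynomial.derivative^[i] f).eval a) =
        sgn ((Polynomial.derivative^[i] f).eval b)) :
    MonotoneOn (fun x => f.eval x) (Set.Icc a b) ∨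
      AntitoneOn (fun x => f.eval x) (Set.Icc a b) :=
  monotoneOn_or_antitoneOn_of_sgn_derivative_eq hab.le d f hdeg hsigns
end

section
/- Let d ≥ 1 be an integer, let f be a nonzero real polynomial of degree at most d, and let s_1 ≤ s_2 ≤ … ≤ s_n be real numbers. Then the number of indices j ∈ {1,…,n−1} for which there exists some i with 0 ≤ i ≤ d such that sign(f^{(i)}(s_j)) ≠ sign(f^{(i)}(s_{j+1})) is at most d(d+1)/2. Consequently, the sorted list s_1,…,s_n can be partitioned into at most d(d+1)/2 + 1 contiguous segments on each of which the sign pattern (sign(f^{(0)}(·)), …, sign(f^{(d)}(·))) is constant. -/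
open Filter Topology

lemma eventually_sgn_add_eq (y : ℝ) :
    ∀ᶠ ε in 𝓝[>] (0 : ℝ), sgn (y + ε) = sgn y ∧ y + ε ≠ 0 := by
  rcases le_or_gt 0 y with hy | hy
  · filter_upwards [self_mem_nhdsWithin] with ε hε
    have hpos : 0 < y + ε := add_pos_of_nonneg_of_pos hy hε
    simp [sgn, hy, hpos.le, hpos.ne']
  · have hsmall : ∀ᶠ ε in 𝓝[>] (0 : ℝ), ε < -y :=
      mem_nhdsWithin_of_mem_nhds (Iio_mem_nhds (by linarith))
    filter_upwards [hsmall] with ε hε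
    have hneg : y + ε < 0 := by linarith
    simp [sgn, hy.not_ge, hneg.not_ge, hneg.ne]

lemma exists_root_of_sgn_ne (p : Polynomial ℝ) {a b : ℝ} (hab : a ≤ b)
    (ha : p.eval a ≠ 0) (hb : p.eval b ≠ 0) (h : sgn (p.eval a) ≠ sgn (p.eval b)) :
    ∃ r ∈ Set.Ioo a b, p.eval r = 0 := by
  rcases ha.lt_or_gt with ha | ha <;> rcases hb.lt_or_gt with hb | hb
  · simp [sgn, ha.not_ge, hb.not_ge] at h
  · exact intermediate_value_Ioo hab p.continuous.continuousOn ⟨ha, hb⟩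
  · exact intermediate_value_Ioo' hab p.continuous.continuousOn ⟨hb, ha⟩
  · simp [sgn, ha.le, hb.le] at h

lemma card_sgn_changes_le_natDegree (p : Polynomial ℝ) (n : ℕ) (s : ℕ → ℝ)
    (hs : ∀ j, j + 1 < n → s j ≤ s (j + 1)) :
    ((Finset.range (n - 1)).filter
      (fun j => sgn (p.eval (s j)) ≠ sgn (p.eval (s (j + 1))))).card ≤ p.natDegree := by
  have hmono : ∀ j k, j ≤ k → k < n → s j ≤ s k := by
    intro j k hjk
    induction k, hjk using Nat.le_induction with
    | base => exact fun _ => le_rfl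
    | succ k _ ih => exact fun hk => (ih (by omega)).trans (hs k hk)
  obtain ⟨ε, hε⟩ := ((Finset.range n).eventually_all.2
    fun j _ => eventually_sgn_add_eq (p.eval (s j))).exists
  set q := p + Polynomial.C ε with hq
  have hsgn : ∀ j < n, sgn (q.eval (s j)) = sgn (p.eval (s j)) ∧ q.eval (s j) ≠ 0 := by
    intro j hj
    simpa [hq] using hε j (Finset.mem_range.2 hj)
  have hroot : ∀ j, ∃ r, j ∈ (Finset.range (n - 1)).filter
      (fun j => sgn (p.eval (s j)) ≠ sgn (p.eval (s (j + 1)))) →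
      r ∈ Set.Ioo (s j) (s (j + 1)) ∧ r ∈ q.roots.toFinset := by
    intro j
    by_cases hj : j ∈ (Finset.range (n - 1)).filter
      (fun j => sgn (p.eval (s j)) ≠ sgn (p.eval (s (j + 1))))
    · obtain ⟨hjn, hne⟩ := Finset.mem_filter.1 hj
      have hjn : j + 1 < n := by have := Finset.mem_range.1 hjn; omega
      obtain ⟨h₁, h₁'⟩ := hsgn j (by omega)
      obtain ⟨h₂, h₂'⟩ := hsgn (j + 1) hjn
      obtain ⟨r, hr, hr0⟩ := exists_root_of_sgn_ne q (hs j hjn) h₁' h₂' (by rwa [h₁, h₂])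
      have hq0 : q ≠ 0 := fun h => h₁' (by simp [h])
      exact ⟨r, fun _ => ⟨hr, by simp [hq0, hr0]⟩⟩
    · exact ⟨0, fun h => absurd h hj⟩
  choose r hr using hroot
  have hlt : ∀ j k, j < k →
      j ∈ (Finset.range (n - 1)).filter
        (fun j => sgn (p.eval (s j)) ≠ sgn (p.eval (s (j + 1)))) →
      k ∈ (Finset.range (n - 1)).filter
        (fun j => sgn (p.eval (s j)) ≠ sgn (p.eval (s (j + 1)))) → r j < r k := by
    intro j k hjk hj hk
    have hkn := Finset.mem_range.1 (Finset.mem_filter.1 hk).1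
    exact (hr j hj).1.2.trans_le ((hmono _ _ hjk (by omega)).trans (hr k hk).1.1.le)
  calc _ ≤ q.roots.toFinset.card := by
        refine Finset.card_le_card_of_injOn r (fun j hj => (hr j hj).2) fun j hj k hk h => ?_
        rcases lt_trichotomy j k with hjk | hjk | hjk
        · exact absurd h (hlt j k hjk hj hk).ne
        · exact hjk
        · exact absurd h (hlt k j hjk hk hj).ne'
    _ ≤ q.roots.card := q.roots.toFinset_card_le
    _ ≤ q.natDegree := q.card_roots'
    _ = p.natDegree := Polynomial.natDegree_add_C


/-- For a nonzero polynomial `f` of degree at most `d` and sorted points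
`s 0 ≤ s 1 ≤ … ≤ s (n-1)`, the number of consecutive pairs at which the sign pattern
`(sign f(·), sign f'(·), …, sign f^{(d)}(·))` changes is at most `d(d+1)/2`;
consequently the sorted list splits into at most `d(d+1)/2 + 1` contiguous segments
of constant sign pattern. -/
theorem stmt1 (d n : ℕ) (hd : 1 ≤ d) (f : Polynomial ℝ) (hf : f ≠ 0)
    (hdeg : f.natDegree ≤ d) (s : ℕ → ℝ)
    (hs : ∀ j, j + 1 < n → s j ≤ s (j + 1)) :
    ((Finset.range (n - 1)).filter (fun j => ∃ i ≤ d,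
        sgn ((Polynomial.derivative^[i] f).eval (s j)) ≠
          sgn ((Polynomial.derivative^[i] f).eval (s (j + 1))))).card
      ≤ d * (d + 1) / 2 := by
  classical
  calc _ ≤ ((Finset.range (d + 1)).biUnion fun i => (Finset.range (n - 1)).filter fun j =>
          sgn ((Polynomial.derivative^[i] f).eval (s j)) ≠
            sgn ((Polynomial.derivative^[i] f).eval (s (j + 1)))).card := by
        refine Finset.card_le_card fun j hj => ?_
        obtain ⟨hj, i, hi, hne⟩ := Finset.mem_filter.1 hj
        exact Finset.mem_biUnion.2
          ⟨i, Finset.mem_range.2 (by omega), Finset.mem_filter.2 ⟨hj, hne⟩⟩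
    _ ≤ ∑ i ∈ Finset.range (d + 1), (d - i) := by
        refine Finset.card_biUnion_le.trans (Finset.sum_le_sum fun i _ => ?_)
        refine (card_sgn_changes_le_natDegree _ n s hs).trans ?_
        exact (Polynomial.natDegree_iterate_derivative f i).trans (by omega)
    _ = ∑ i ∈ Finset.range (d + 1), i := by
        simpa using Finset.sum_range_reflect (fun i => i) (d + 1)
    _ = d * (d + 1) / 2 := by
        rw [Finset.sum_range_id, Nat.add_sub_cancel, mul_comm]
end

section
/- Let d ≥ 1 be an integer, let f be a real polynomial of degree at most d, and let S = {s_1 < s_2 < … < s_n} be a set of n ≥ d² + d + 3 real numbers. Then there exists an index j with 1 ≤ j ≤ n−2 such that the three consecutive points s_j, s_{j+1}, s_{j+2} all have the same sign pattern with respect to f, i.e., sign(f^{(i)}(s_j)) = sign(f^{(i)}(s_{j+1})) = sign(f^{(i)}(s_{j+2})) for every 0 ≤ i ≤ d. -/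
lemma exists_pos_forall_add_neg {n : ℕ} (a : ℕ → ℝ) :
    ∃ ε > 0, ∀ k ∈ Finset.range n, a k < 0 → a k + ε < 0 := by
  have h : ∀ᶠ ε in nhdsWithin (0 : ℝ) (Set.Ioi 0),
      ∀ k ∈ Finset.range n, a k < 0 → a k + ε < 0 := by
    rw [Filter.eventually_all_finset]
    intro k _
    by_cases hk : a k < 0
    · have : ∀ᶠ ε in nhdsWithin (0 : ℝ) (Set.Ioi 0), ε < -a k :=
        nhdsWithin_le_nhds (Iio_mem_nhds (by linarith))
      filter_upwards [this] with ε hε _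
      linarith
    · exact Filter.Eventually.of_forall fun _ h => absurd h hk
  obtain ⟨ε, hε, hpos⟩ := (h.and self_mem_nhdsWithin).exists
  exact ⟨ε, hpos, hε⟩

/-- A polynomial has at most as many sign changes along an increasing sequence as its degree. -/
lemma card_sgn_changes_le (p : Polynomial ℝ) (n : ℕ) (s : ℕ → ℝ)
    (hs : ∀ j k, j < k → k < n → s j < s k) :
    ((Finset.range (n - 1)).filter
      fun k => sgn (p.eval (s k)) ≠ sgn (p.eval (s (k + 1)))).card ≤ p.natDegree := by
  obtain ⟨ε, hε, hneg⟩ := exists_pos_forall_add_neg (n := n) fun k => p.eval (s k)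
  set q := p + Polynomial.C ε with hq
  have root : ∀ k, k ∈ (Finset.range (n - 1)).filter
      (fun k => sgn (p.eval (s k)) ≠ sgn (p.eval (s (k + 1)))) →
      ∃ r ∈ Set.Ioo (s k) (s (k + 1)), q.eval r = 0 ∧ q ≠ 0 := by
    intro k hk
    obtain ⟨hkn, hne⟩ := Finset.mem_filter.1 hk
    rw [Finset.mem_range] at hkn
    have h1 := hneg k (Finset.mem_range.2 (by lia))
    have h2 := hneg (k + 1) (Finset.mem_range.2 (by lia))
    have hlt := (hs k (k + 1) (by lia) (by lia)).le
    have e : ∀ x, q.eval x = p.eval x + ε := fun x => by simp [hq]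
    have hc : ContinuousOn (fun x => q.eval x) (Set.Icc (s k) (s (k + 1))) :=
      q.continuous.continuousOn
    have hq0 : q ≠ 0 := by
      intro h0
      have e1 := e (s k)
      have e2 := e (s (k + 1))
      simp only [h0, Polynomial.eval_zero] at e1 e2
      exact hne (by rw [show p.eval (s k) = p.eval (s (k + 1)) by linarith])
    unfold sgn at hne
    by_cases ha : 0 ≤ p.eval (s k) <;> by_cases hb : 0 ≤ p.eval (s (k + 1)) <;>
      simp only [ha, hb, if_true, if_false, ne_eq, not_true_eq_false] at hne
    · obtain ⟨r, hr, h0⟩ := intermediate_value_Ioo' hlt hc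
        (show (0 : ℝ) ∈ Set.Ioo _ _ from
          ⟨by rw [e]; exact h2 (not_le.1 hb), by rw [e]; linarith⟩)
      exact ⟨r, hr, h0, hq0⟩
    · obtain ⟨r, hr, h0⟩ := intermediate_value_Ioo hlt hc
        (show (0 : ℝ) ∈ Set.Ioo _ _ from
          ⟨by rw [e]; exact h1 (not_le.1 ha), by rw [e]; linarith⟩)
      exact ⟨r, hr, h0, hq0⟩
  choose! r hr h0 hq0 using root
  have hmono : ∀ j k, j < k → k + 1 < n → s (j + 1) ≤ s k := by
    intro j k hjk hk
    rcases (Nat.succ_le_of_lt hjk).eq_or_lt with h | h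
    · rw [← h]
    · exact (hs _ _ h (by lia)).le
  calc _ ≤ q.roots.toFinset.card := by
        refine Finset.card_le_card_of_injOn r (fun k hk => ?_) fun j hj k hk hjk => ?_
        · simpa using ⟨hq0 k hk, h0 k hk⟩
        · have hjn := Finset.mem_range.1 (Finset.mem_filter.1 hj).1
          have hkn := Finset.mem_range.1 (Finset.mem_filter.1 hk).1
          have h1 := hr j hj
          have h2 := hr k hk
          rcases lt_trichotomy j k with h | h | h
          · have := hmono j k h (by lia)
            linarith [h1.2, h2.1]
          · exact h
          · have := hmono k j h (by lia)
            linarith [h1.1, h2.2]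
    _ ≤ q.roots.card := Multiset.toFinset_card_le _
    _ ≤ q.natDegree := q.card_roots'
    _ = p.natDegree := Polynomial.natDegree_add_C

/-- Among `n ≥ d² + d + 3` increasing points, some three consecutive points have the
same sign pattern with respect to a polynomial `f` of degree at most `d`. -/
theorem stmt2 (d n : ℕ) (hd : 1 ≤ d) (f : Polynomial ℝ) (hdeg : f.natDegree ≤ d)
    (hn : d ^ 2 + d + 3 ≤ n) (s : ℕ → ℝ)
    (hs : ∀ j k, j < k → k < n → s j < s k) :
    ∃ j, j + 2 < n ∧ ∀ i ≤ d,
      sgn ((Polynomial.derivative^[i] f).eval (s j)) =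
        sgn ((Polynomial.derivative^[i] f).eval (s (j + 1))) ∧
      sgn ((Polynomial.derivative^[i] f).eval (s (j + 1))) =
        sgn ((Polynomial.derivative^[i] f).eval (s (j + 2))) := by
  by_contra! hcon
  let E := (Finset.range (d + 1)).biUnion fun i => (Finset.range (n - 1)).filter fun k =>
    sgn ((Polynomial.derivative^[i] f).eval (s k)) ≠
      sgn ((Polynomial.derivative^[i] f).eval (s (k + 1)))
  have hE : E.card ≤ ∑ i ∈ Finset.range (d + 1), (d - i) :=
    Finset.card_biUnion_le.trans <| Finset.sum_le_sum fun i _ =>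
      (card_sgn_changes_le _ n s hs).trans <|
        (Polynomial.natDegree_iterate_derivative f i).trans (Nat.sub_le_sub_right hdeg i)
  rw [Finset.sum_flip fun i => i] at hE
  have hsum := Finset.sum_range_id_mul_two (d + 1)
  have hE2 : E.card * 2 ≤ d ^ 2 + d := by
    rw [Nat.add_sub_cancel] at hsum
    nlinarith
  have hsub : Finset.range (E.card + 1) ⊆ E.image (· / 2) := by
    intro m hm
    rw [Finset.mem_range] at hm
    obtain ⟨i, hi, hch⟩ := hcon (2 * m) (by lia)
    rw [Finset.mem_image]
    by_cases h : sgn ((Polynomial.derivative^[i] f).eval (s (2 * m))) =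
        sgn ((Polynomial.derivative^[i] f).eval (s (2 * m + 1)))
    · refine ⟨2 * m + 1, Finset.mem_biUnion.2 ⟨i, Finset.mem_range.2 (by lia), ?_⟩, by lia⟩
      exact Finset.mem_filter.2 ⟨Finset.mem_range.2 (by lia), hch h⟩
    · refine ⟨2 * m, Finset.mem_biUnion.2 ⟨i, Finset.mem_range.2 (by lia), ?_⟩, by lia⟩
      exact Finset.mem_filter.2 ⟨Finset.mem_range.2 (by lia), h⟩
  have hcard := (Finset.card_le_card hsub).trans Finset.card_image_le
  rw [Finset.card_range] at hcard
  lia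
end

section
/- Let d ≥ 1 be an integer, let S ⊂ ℝ be a finite set with |S| ≥ d² + d + 3, and let f be a real polynomial of degree at most d. Then there exists a point x ∈ S such that for every real polynomial g of degree at most d satisfying sign(g^{(i)}(s)) = sign(f^{(i)}(s)) for all s ∈ S \ {x} and all 0 ≤ i ≤ d, it holds that sign(g(x)) = sign(f(x)). (In other words, the inference dimension of degree-d univariate polynomial threshold functions with derivative queries is at most d² + d + 3.) -/
open Polynomial in
/-- A polynomial takes opposite signs at the endpoints of at most `natDegree` many consecutive
intervals, zeros being counted as positive. -/
lemma card_sgn_changes_le_natDegree_s3 {m : ℕ} (t : Fin (m + 1) → ℝ) (ht : StrictMono t)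
    (p : ℝ[X]) :
    (Finset.univ.filter fun j : Fin m =>
      sgn (p.eval (t j.castSucc)) ≠ sgn (p.eval (t j.succ))).card ≤ p.natDegree := by
  classical
  obtain ⟨ε, hε, hneg⟩ : ∃ ε : ℝ, 0 < ε ∧ ∀ j, p.eval (t j) < 0 → p.eval (t j) + ε < 0 := by
    have h : ∀ᶠ ε in nhdsWithin (0 : ℝ) (Set.Ioi 0),
        0 < ε ∧ ∀ j, p.eval (t j) < 0 → p.eval (t j) + ε < 0 := by
      refine Filter.Eventually.and self_mem_nhdsWithin ?_
      rw [Filter.eventually_all]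
      intro j
      by_cases hj : p.eval (t j) < 0
      · filter_upwards [nhdsWithin_le_nhds (Iio_mem_nhds (neg_pos.mpr hj))] with ε hε _
        have : ε < -p.eval (t j) := hε
        linarith
      · exact Filter.Eventually.of_forall fun _ h => absurd h hj
    exact h.exists
  set q : ℝ[X] := p + C ε with hq
  have hqe : ∀ x, q.eval x = p.eval x + ε := fun x => by simp [hq]
  have hroot : ∀ j : Fin m, ∃ r, sgn (p.eval (t j.castSucc)) ≠ sgn (p.eval (t j.succ)) →
      t j.castSucc < r ∧ r < t j.succ ∧ r ∈ q.roots.toFinset := by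
    intro j
    by_cases hj : sgn (p.eval (t j.castSucc)) ≠ sgn (p.eval (t j.succ))
    swap
    · exact ⟨0, fun h => absurd h hj⟩
    have hlt : t j.castSucc < t j.succ := ht Fin.castSucc_lt_succ
    have ha : q.eval (t j.castSucc) ≠ 0 := by
      rw [hqe]
      rcases lt_or_ge (p.eval (t j.castSucc)) 0 with h | h
      · exact (hneg _ h).ne
      · positivity
    have hb : q.eval (t j.succ) ≠ 0 := by
      rw [hqe]
      rcases lt_or_ge (p.eval (t j.succ)) 0 with h | h
      · exact (hneg _ h).ne
      · positivity
    have hzero : (0 : ℝ) ∈ Set.uIcc (q.eval (t j.castSucc)) (q.eval (t j.succ)) := by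
      rw [Set.mem_uIcc, hqe, hqe]
      rcases lt_or_ge (p.eval (t j.castSucc)) 0 with h | h <;>
        rcases lt_or_ge (p.eval (t j.succ)) 0 with h' | h'
      · exact absurd (by simp [sgn, h.not_ge, h'.not_ge]) hj
      · exact Or.inl ⟨(hneg _ h).le, by positivity⟩
      · exact Or.inr ⟨(hneg _ h').le, by positivity⟩
      · exact absurd (by simp [sgn, h, h']) hj
    obtain ⟨r, hr, hr0⟩ := intermediate_value_uIcc q.continuous.continuousOn hzero
    rw [Set.uIcc_of_le hlt.le] at hr
    refine ⟨r, fun _ => ⟨lt_of_le_of_ne hr.1 ?_, lt_of_le_of_ne hr.2 ?_, ?_⟩⟩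
    · rintro rfl; exact ha hr0
    · rintro rfl; exact hb hr0
    · rw [Multiset.mem_toFinset, mem_roots']
      exact ⟨fun h => ha (by simp [h]), hr0⟩
  choose r hr using hroot
  have hmono : ∀ i j : Fin m, sgn (p.eval (t i.castSucc)) ≠ sgn (p.eval (t i.succ)) →
      sgn (p.eval (t j.castSucc)) ≠ sgn (p.eval (t j.succ)) → i < j → r i < r j := by
    intro i j hi hj hij
    have h : t i.succ ≤ t j.castSucc := ht.monotone (Fin.succ_le_castSucc_iff.mpr hij)
    linarith [(hr i hi).2.1, (hr j hj).1]
  calc _ ≤ q.roots.toFinset.card := by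
        refine Finset.card_le_card_of_injOn r ?_ ?_
        · intro j hj
          exact (hr j (by simpa using hj)).2.2
        · intro i hi j hj hij
          replace hi : sgn (p.eval (t i.castSucc)) ≠ sgn (p.eval (t i.succ)) := by simpa using hi
          replace hj : sgn (p.eval (t j.castSucc)) ≠ sgn (p.eval (t j.succ)) := by simpa using hj
          rcases lt_trichotomy i j with h | h | h
          · exact absurd hij (hmono i j hi hj h).ne
          · exact h
          · exact absurd hij (hmono j i hj hi h).ne'
    _ ≤ q.roots.card := Multiset.toFinset_card_le _
    _ ≤ q.natDegree := q.card_roots'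
    _ ≤ p.natDegree := by rw [hq, natDegree_add_C]

lemma sgn_mono : Monotone sgn := by
  intro a b hab
  unfold sgn
  split_ifs <;> linarith

open Polynomial in
/-- If every derivative of `g` has the same sign at `a` and `b`, then `g` has constant sign on
`[a, b]`. -/
lemma sgn_eval_eq_of_sgn_derivatives_eq {a b : ℝ} (n : ℕ) :
    ∀ g : ℝ[X], g.natDegree ≤ n →
      (∀ i ≤ n, sgn ((derivative^[i] g).eval a) = sgn ((derivative^[i] g).eval b)) →
      ∀ x ∈ Set.Icc a b, sgn (g.eval x) = sgn (g.eval a) := by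
  induction n with
  | zero =>
    intro g hg _ x _
    rw [eq_C_of_natDegree_le_zero hg]
    simp
  | succ n ih =>
    intro g hg h x hx
    have hab : a ≤ b := hx.1.trans hx.2
    have hd := ih (derivative g) ((natDegree_derivative_le g).trans (by omega))
      fun i hi => by simpa only [Function.iterate_succ_apply] using h (i + 1) (by omega)
    have h0 : sgn (g.eval a) = sgn (g.eval b) := h 0 (by omega)
    rcases lt_or_ge ((derivative g).eval a) 0 with hs | hs
    · have hanti : AntitoneOn (fun y => g.eval y) (Set.Icc a b) := by
        refine antitoneOn_of_deriv_nonpos (convex_Icc a b) g.continuous.continuousOn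
          g.differentiable.differentiableOn fun y hy => ?_
        rw [Polynomial.deriv]
        have := hd y (interior_subset hy)
        by_contra! hc
        norm_num [sgn, hc.le, hs.not_ge] at this
      refine le_antisymm (sgn_mono (hanti ⟨le_rfl, hab⟩ hx hx.1)) ?_
      rw [h0]
      exact sgn_mono (hanti hx ⟨hab, le_rfl⟩ hx.2)
    · have hmono : MonotoneOn (fun y => g.eval y) (Set.Icc a b) := by
        refine monotoneOn_of_deriv_nonneg (convex_Icc a b) g.continuous.continuousOn
          g.differentiable.differentiableOn fun y hy => ?_
        rw [Polynomial.deriv]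
        have := hd y (interior_subset hy)
        by_contra! hc
        norm_num [sgn, hc.not_ge, hs] at this
      refine le_antisymm ?_ (sgn_mono (hmono ⟨le_rfl, hab⟩ hx hx.1))
      rw [h0]
      exact sgn_mono (hmono hx ⟨hab, le_rfl⟩ hx.2)

open Polynomial in
/-- Among more than `d (d + 1) / 2` consecutive intervals, there is one on which no derivative of
`f` changes sign. -/
lemma exists_interval_sgn_derivatives_eq {d m : ℕ} (hm : d * (d + 1) < 2 * m)
    (t : Fin (m + 1) → ℝ) (ht : StrictMono t) (f : ℝ[X]) (hf : f.natDegree ≤ d) :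
    ∃ j : Fin m, ∀ i ≤ d, sgn ((derivative^[i] f).eval (t j.castSucc)) =
      sgn ((derivative^[i] f).eval (t j.succ)) := by
  classical
  by_contra! hcon
  have hcover : (Finset.univ : Finset (Fin m)) ⊆ (Finset.range (d + 1)).biUnion fun i =>
      Finset.univ.filter fun j : Fin m => sgn ((derivative^[i] f).eval (t j.castSucc)) ≠
        sgn ((derivative^[i] f).eval (t j.succ)) := by
    intro j _
    obtain ⟨i, hi, hne⟩ := hcon j
    simp only [Finset.mem_biUnion, Finset.mem_range, Finset.mem_filter]
    exact ⟨i, by omega, Finset.mem_univ j, hne⟩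
  have hle : m ≤ ∑ i ∈ Finset.range (d + 1), (d - i) := by
    calc m = (Finset.univ : Finset (Fin m)).card := by simp
      _ ≤ _ := Finset.card_le_card hcover
      _ ≤ _ := Finset.card_biUnion_le
      _ ≤ _ := Finset.sum_le_sum fun i _ =>
        (card_sgn_changes_le_natDegree_s3 t ht _).trans
          ((natDegree_iterate_derivative f i).trans (by omega))
  have hsum : ∑ i ∈ Finset.range (d + 1), (d - i) = ∑ i ∈ Finset.range (d + 1), i := by
    simpa using Finset.sum_range_reflect (fun i => i) (d + 1)
  have hgauss := Finset.sum_range_id_mul_two (d + 1)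
  simp only [Nat.add_sub_cancel] at hgauss
  nlinarith

/-- Inference dimension upper bound: for any finite set `S ⊂ ℝ` with
`|S| ≥ d² + d + 3` and any polynomial `f` of degree at most `d`, there is a point
`x ∈ S` whose label `sign f(x)` is determined by the derivative-query answers
on `S \ {x}`. -/
theorem stmt3 (d : ℕ) (hd : 1 ≤ d) (S : Finset ℝ) (hS : d ^ 2 + d + 3 ≤ S.card)
    (f : Polynomial ℝ) (hdeg : f.natDegree ≤ d) :
    ∃ x ∈ S, ∀ g : Polynomial ℝ, g.natDegree ≤ d →
      (∀ s ∈ S.erase x, ∀ i ≤ d,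
        sgn ((Polynomial.derivative^[i] g).eval s) =
          sgn ((Polynomial.derivative^[i] f).eval s)) →
      sgn (g.eval x) = sgn (f.eval x) := by
  obtain ⟨k, hk⟩ : ∃ k, d * (d + 1) = 2 * k := (Nat.even_mul_succ_self d).two_dvd
  have hcard : 2 * (k + 1) + 1 ≤ S.card := by nlinarith
  let s := S.orderEmbOfFin rfl
  have hsS : ∀ l, s l ∈ S := S.orderEmbOfFin_mem rfl
  let t : Fin (k + 1 + 1) → ℝ := fun j => s ⟨2 * j, by omega⟩
  have ht : StrictMono t := fun i j hij => s.strictMono (by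
    rw [Fin.mk_lt_mk]; have : (i : ℕ) < j := hij; omega)
  obtain ⟨j, hj⟩ := exists_interval_sgn_derivatives_eq (by omega) t ht f hdeg
  have hax : t j.castSucc < s ⟨2 * j + 1, by omega⟩ := s.strictMono (by
    rw [Fin.mk_lt_mk, Fin.val_castSucc]; omega)
  have hxb : s ⟨2 * j + 1, by omega⟩ < t j.succ := s.strictMono (by
    rw [Fin.mk_lt_mk, Fin.val_succ]; omega)
  refine ⟨s ⟨2 * j + 1, by omega⟩, hsS _, fun g hg h => ?_⟩
  have ha := h (t j.castSucc) (Finset.mem_erase.mpr ⟨hax.ne, hsS _⟩)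
  have hb := h (t j.succ) (Finset.mem_erase.mpr ⟨hxb.ne', hsS _⟩)
  have hx : s ⟨2 * j + 1, by omega⟩ ∈ Set.Icc (t j.castSucc) (t j.succ) := ⟨hax.le, hxb.le⟩
  rw [sgn_eval_eq_of_sgn_derivatives_eq d g hg
      (fun i hi => by rw [ha i hi, hb i hi, hj i hi]) _ hx,
    sgn_eval_eq_of_sgn_derivatives_eq d f hdeg hj _ hx]
  exact ha 0 (Nat.zero_le d)
end

section
/- For all integers d ≥ 2, i with 1 ≤ i ≤ d−1, and n ≥ 1, there exist a real polynomial h of degree at most d, real numbers s_1 < s_2 < … < s_n, and real polynomials h_1, …, h_n each of degree at most d, such that for every t ∈ {1,…,n}: (1) sign(h_t^{(k)}(s_j)) = sign(h^{(k)}(s_j)) for all j ≠ t and all k ∈ {0,1,…,d} with k ≠ i; and (2) sign(h_t(s_t)) ≠ sign(h(s_t)). (In other words, if a learner may query labels and all derivatives except the i-th, the inference dimension of degree-d univariate polynomial threshold functions is infinite.) -/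
open Polynomial in
/-- A degree-`(i + 1)` polynomial that is negative at `1`, while all of its derivatives except
possibly the `i`-th are nonnegative just to the right of `0` and on `[2, ∞)`. -/
lemma exists_polynomial_dip (i : ℕ) :
    ∃ p : ℝ[X], p.natDegree ≤ i + 1 ∧ p.eval 1 < 0 ∧ ∃ δ : ℝ, 0 < δ ∧
      ∀ k ≠ i, ∀ x : ℝ, 0 ≤ x → (x ≤ δ ∨ 2 ≤ x) → 0 ≤ (derivative^[k] p).eval x := by
  set ε : ℝ := (1 / 2) ^ (i + 1) with hε
  have hε0 : 0 < ε := by positivity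
  have hε1 : ε ≤ 1 := pow_le_one₀ (by norm_num) (by norm_num)
  refine ⟨X ^ (i + 1) - C 2 * X ^ i + C ε * (X + C 1) ^ i, by compute_degree!, ?_, ε / 2,
    by positivity, ?_⟩
  · have h : ε * 2 ^ i = 1 / 2 := by
      rw [hε, pow_succ, mul_right_comm, ← mul_pow]; norm_num
    simp only [eval_add, eval_sub, eval_mul, eval_pow, eval_X, eval_C, one_pow]
    rw [one_add_one_eq_two, h]; norm_num
  · intro k hk x hx0 hx
    have hder : (derivative^[k] (X ^ (i + 1) - C 2 * X ^ i + C ε * (X + C 1) ^ i)).eval x =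
        ((i + 1).descFactorial k : ℝ) * x ^ (i + 1 - k) - 2 * (i.descFactorial k * x ^ (i - k))
          + ε * (i.descFactorial k * (x + 1) ^ (i - k)) := by
      rw [iterate_map_add, iterate_map_sub, iterate_derivative_C_mul, iterate_derivative_C_mul,
        iterate_derivative_X_pow_eq_smul, iterate_derivative_X_pow_eq_smul,
        iterate_derivative_X_add_pow]
      simp [mul_left_comm]
    rw [hder]
    rcases lt_or_gt_of_ne hk with hlt | hgt
    · have hmono : (i.descFactorial k : ℝ) ≤ (i + 1).descFactorial k := by
        exact_mod_cast Nat.descFactorial_le k (Nat.le_succ i)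
      obtain ⟨m, rfl⟩ := Nat.exists_eq_add_of_lt hlt
      have e1 : k + m + 1 + 1 - k = m + 2 := by omega
      have e2 : k + m + 1 - k = m + 1 := by omega
      rw [e1, e2]
      set a : ℝ := ((k + m + 1).descFactorial k : ℝ)
      set b : ℝ := ((k + m + 1 + 1).descFactorial k : ℝ)
      have ha : 0 ≤ a := Nat.cast_nonneg _
      have hb : 0 ≤ b := Nat.cast_nonneg _
      rcases hx with hx | hx
      · have h1 : x ^ (m + 1) ≤ x := by
          simpa using pow_le_pow_of_le_one hx0 (by linarith) (Nat.succ_le_succ (Nat.zero_le m))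
        have h2 : (1 : ℝ) ≤ (x + 1) ^ (m + 1) := one_le_pow₀ (by linarith)
        have h3 : 0 ≤ b * x ^ (m + 2) := by positivity
        have h4 : 0 ≤ a * (ε * (x + 1) ^ (m + 1) - 2 * x ^ (m + 1)) :=
          mul_nonneg ha (by nlinarith)
        linarith
      · have h1 : 0 ≤ ε * (a * (x + 1) ^ (m + 1)) := by positivity
        have h2 : a * 2 ≤ b * x := by gcongr
        have h3 := mul_le_mul_of_nonneg_right h2 (pow_nonneg hx0 (m + 1))
        rw [pow_succ x (m + 1)]
        linarith
    · rw [Nat.descFactorial_of_lt hgt]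
      simp only [Nat.cast_zero, zero_mul, mul_zero, sub_zero, add_zero]
      positivity

open Polynomial in
lemma eval_iterate_derivative_comp_C_mul_X (p : ℝ[X]) (c x : ℝ) (k : ℕ) :
    (derivative^[k] (p.comp (C c * X))).eval x = c ^ k * (derivative^[k] p).eval (c * x) := by
  induction k generalizing p with
  | zero => simp
  | succ k ih =>
    rw [Function.iterate_succ_apply, Function.iterate_succ_apply, derivative_comp,
      derivative_C_mul, derivative_X, mul_one, iterate_derivative_C_mul, eval_C_mul, ih]
    ring

/-- If the learner may query labels and all derivatives except the `i`-th
(`1 ≤ i ≤ d − 1`), then for every `n` there are a degree-≤`d` polynomial `h`, points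
`s 0 < … < s (n-1)`, and degree-≤`d` polynomials `H t` such that each `H t` answers all
allowed queries identically to `h` on all points other than `s t`, yet disagrees with
`h` on the label of `s t`: the inference dimension is infinite. -/
theorem stmt5 (d i n : ℕ) (hd : 2 ≤ d) (hi1 : 1 ≤ i) (hi2 : i ≤ d - 1) (hn : 1 ≤ n) :
    ∃ (h : Polynomial ℝ) (s : Fin n → ℝ) (H : Fin n → Polynomial ℝ),
      h.natDegree ≤ d ∧ StrictMono s ∧ (∀ t, (H t).natDegree ≤ d) ∧
      ∀ t : Fin n,
        (∀ j : Fin n, j ≠ t → ∀ k ≤ d, k ≠ i →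
          sgn ((Polynomial.derivative^[k] (H t)).eval (s j)) =
            sgn ((Polynomial.derivative^[k] h).eval (s j))) ∧
        sgn ((H t).eval (s t)) ≠ sgn (h.eval (s t)) := by
  obtain ⟨p, hdeg, hneg, δ, hδ, hp⟩ := exists_polynomial_dip i
  set r : ℝ := max 2 δ⁻¹
  have hr2 : 2 ≤ r := le_max_left _ _
  have hr0 : 0 < r := by linarith
  have hrδ : r⁻¹ ≤ δ := inv_le_of_inv_le₀ hδ (le_max_right _ _)
  refine ⟨0, fun j => r ^ (j : ℕ),
    fun t => p.comp (Polynomial.C (r ^ (t : ℕ))⁻¹ * Polynomial.X), by simp, ?_, ?_, ?_⟩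
  · intro a b hab
    exact pow_lt_pow_right₀ (by linarith) hab
  · intro t
    refine Polynomial.natDegree_comp_le.trans ?_
    have h1 : (Polynomial.C (r ^ (t : ℕ))⁻¹ * Polynomial.X).natDegree ≤ 1 := by compute_degree
    have h2 := Nat.mul_le_mul hdeg h1
    omega
  · intro t
    refine ⟨fun j hj k _ hk => ?_, ?_⟩
    · have h0 : 0 ≤ (r ^ (t : ℕ))⁻¹ * r ^ (j : ℕ) := by positivity
      have hnonneg := hp k hk _ h0 <| by
        rcases lt_or_gt_of_ne hj with hlt | hgt
        · left
          refine le_trans ?_ hrδ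
          rw [inv_mul_le_iff₀ (by positivity), ← div_eq_mul_inv, le_div_iff₀ hr0, ← pow_succ]
          exact pow_le_pow_right₀ (by linarith) hlt
        · right
          rw [le_inv_mul_iff₀ (by positivity)]
          calc r ^ (t : ℕ) * 2 ≤ r ^ (t : ℕ) * r := by gcongr
            _ = r ^ ((t : ℕ) + 1) := (pow_succ _ _).symm
            _ ≤ r ^ (j : ℕ) := pow_le_pow_right₀ (by linarith) hgt
      rw [eval_iterate_derivative_comp_C_mul_X, Polynomial.iterate_derivative_zero,
        Polynomial.eval_zero, sgn, sgn, if_pos (mul_nonneg (by positivity) hnonneg),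
        if_pos le_rfl]
    · have h1 : (r ^ (t : ℕ))⁻¹ * r ^ (t : ℕ) = 1 := inv_mul_cancel₀ (by positivity)
      simp only [Polynomial.eval_comp, Polynomial.eval_mul, Polynomial.eval_C, Polynomial.eval_X,
        Polynomial.eval_zero, h1, sgn, if_neg hneg.not_ge, le_refl, if_true]
      norm_num
end

section
/- For every integer d ≥ 1, there exist a real polynomial h of degree exactly d, real numbers s_1 < s_2 < … < s_d, and real polynomials g_1, …, g_d each of degree at most d, such that for every i ∈ {1,…,d}: (1) sign(g_i(s_i)) ≠ sign(h(s_i)); and (2) sign(g_i^{(k)}(s_j)) = sign(h^{(k)}(s_j)) for all j ≠ i and all 0 ≤ k ≤ d. (In other words, the inference dimension of degree-d univariate polynomial threshold functions with full derivative queries is at least d.) -/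
open Polynomial Filter Topology in
theorem iterate_derivative_mul_X_sub_C (p : ℝ[X]) (a : ℝ) (k : ℕ) :
    derivative^[k + 1] (p * (X - C a)) =
      derivative^[k + 1] p * (X - C a) + (k + 1 : ℝ[X]) * derivative^[k] p := by
  induction k with
  | zero => simp
  | succ k ih =>
    rw [Function.iterate_succ_apply', ih]
    simp only [derivative_add, derivative_mul, derivative_sub, derivative_X, derivative_C,
      Function.iterate_succ_apply', derivative_natCast, derivative_one]
    push_cast
    ring

open Polynomial Filter Topology in
/-- There are `d` distinct real numbers at which no derivative of order between `1` and `d` of the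
monic polynomial vanishing exactly at them is zero. -/
theorem exists_strictMono_iterate_derivative_ne_zero (d : ℕ) :
    ∃ s : Fin d → ℝ, StrictMono s ∧ ∀ j : Fin d, ∀ k < d,
      (derivative^[k + 1] (∏ i, (X - C (s i)))).eval (s j) ≠ 0 := by
  induction d with
  | zero => exact ⟨Fin.elim0, fun i => i.elim0, fun i => i.elim0⟩
  | succ d ih =>
    obtain ⟨s, hs, hne⟩ := ih
    set p : ℝ[X] := ∏ i, (X - C (s i)) with hp
    have hmonic : p.Monic := monic_prod_of_monic _ _ fun i _ => monic_X_sub_C _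
    have hdeg : p.natDegree = d := by simp [hp, natDegree_prod_of_monic, monic_X_sub_C]
    have hder : ∀ k ≤ d, derivative^[k] p ≠ 0 := by
      intro k hk h0
      have := coeff_iterate_derivative (p := p) (k := k) (d - k)
      rw [h0, Nat.sub_add_cancel hk, ← hdeg, hmonic.coeff_natDegree, hdeg] at this
      have h1 : d.descFactorial k = 0 := by simpa using this.symm
      exact hk.not_gt (Nat.descFactorial_eq_zero_iff_lt.1 h1)
    have hlarge : ∀ᶠ T : ℝ in atTop, ∀ j, s j < T :=
      eventually_all.2 fun j => eventually_gt_atTop _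
    have hold : ∀ᶠ T : ℝ in atTop, ∀ j, ∀ k : Fin d,
        T ≠ s j + (k + 1) * (derivative^[k] p).eval (s j) / (derivative^[k + 1] p).eval (s j) :=
      eventually_all.2 fun j => eventually_all.2 fun k => eventually_ne_atTop _
    have hnew : ∀ᶠ T : ℝ in atTop, ∀ k : Fin (d + 1), (derivative^[k] p).eval T ≠ 0 := by
      refine eventually_all.2 fun k => ?_
      have := finite_setOfPred_isRoot (hder k (by omega))
      exact atTop_le_cofinite this.eventually_cofinite_notMem
    obtain ⟨T, hT, hTold, hTnew⟩ := (hlarge.and (hold.and hnew)).exists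
    have hprod : ∏ i, (X - C ((Fin.snoc s T : Fin (d + 1) → ℝ) i)) = p * (X - C T) := by
      simp [Fin.prod_univ_castSucc, hp]
    refine ⟨Fin.snoc s T, ?_, ?_⟩
    · intro a b hab
      induction b using Fin.lastCases with
      | last =>
        induction a using Fin.lastCases with
        | last => exact absurd hab (lt_irrefl _)
        | cast a => simpa using hT a
      | cast b =>
        induction a using Fin.lastCases with
        | last => exact absurd hab (Fin.castSucc_lt_last b).not_gt
        | cast a => simpa using hs (by simpa using hab)
    · intro j k hk
      rw [hprod, iterate_derivative_mul_X_sub_C]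
      have hk1 : (k + 1 : ℝ) ≠ 0 := by positivity
      induction j using Fin.lastCases with
      | last => simpa using ⟨hk1, hTnew ⟨k, hk⟩⟩
      | cast j =>
        rcases Nat.lt_succ_iff_lt_or_eq.1 hk with hkd | rfl
        · have h1 := hne j k hkd
          have h2 := hTold j ⟨k, hkd⟩
          simp only [Fin.snoc_castSucc, eval_add, eval_mul, eval_sub, eval_X, eval_C,
            eval_natCast, eval_one]
          contrapose! h2
          field_simp
          linarith
        · have h0 : derivative^[k + 1] p = 0 :=
            iterate_derivative_eq_zero (by omega)
          have hc : derivative^[k] p = C ((derivative^[k] p).coeff 0) :=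
            eq_C_of_natDegree_le_zero ((natDegree_iterate_derivative p k).trans (by omega))
          have hc0 : (derivative^[k] p).coeff 0 ≠ 0 := by
            intro h
            exact hder k le_rfl (by rw [hc, h, C_0])
          rw [h0, hc]
          simpa using ⟨hk1, hc0⟩

open Filter Topology in
theorem eventually_sgn_sub_mul_eq {a : ℝ} (ha : a ≠ 0) (b : ℝ) :
    ∀ᶠ ε in 𝓝[>] (0 : ℝ), sgn (a - ε * b) = sgn a := by
  have hlim : Tendsto (fun ε : ℝ => a - ε * b) (𝓝[>] 0) (𝓝 a) := by
    have : Continuous fun ε : ℝ => a - ε * b := by fun_prop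
    simpa using (this.tendsto 0).mono_left nhdsWithin_le_nhds
  rcases ha.lt_or_gt with h | h
  · filter_upwards [hlim.eventually_lt_const h] with ε hε
    simp [sgn, hε.not_ge, h.not_ge]
  · filter_upwards [hlim.eventually_const_lt h] with ε hε
    simp [sgn, hε.le, h.le]

open Polynomial Filter Topology in
/-- If the zeros `s j` of `h` are not zeros of its derivatives of order `1, …, d`, then a small
perturbation of `h` turns its label at `s i` while keeping all other derivative queries. -/
theorem exists_perturbation {d : ℕ} {h : ℝ[X]} {s : Fin d → ℝ} (hh : h.natDegree ≤ d)
    (hs : Function.Injective s) (hzero : ∀ j, h.eval (s j) = 0)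
    (hne : ∀ j, ∀ k < d, (derivative^[k + 1] h).eval (s j) ≠ 0) (i : Fin d) :
    ∃ g : ℝ[X], g.natDegree ≤ d ∧ sgn (g.eval (s i)) ≠ sgn (h.eval (s i)) ∧
      ∀ j, j ≠ i → ∀ k ≤ d,
        sgn ((derivative^[k] g).eval (s j)) = sgn ((derivative^[k] h).eval (s j)) := by
  set q : ℝ[X] := ∏ j ∈ Finset.univ.erase i, (X - C (s j)) with hq
  set r : ℝ[X] := C (q.eval (s i)) * q with hr
  have hqi : q.eval (s i) ≠ 0 := by
    rw [hq, eval_prod, Finset.prod_ne_zero_iff]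
    intro j hj
    simpa [sub_eq_zero] using fun h => (Finset.ne_of_mem_erase hj) (hs h).symm
  have hrj : ∀ j, j ≠ i → r.eval (s j) = 0 := by
    intro j hj
    have : q.eval (s j) = 0 := by
      rw [hq, eval_prod]
      exact Finset.prod_eq_zero (Finset.mem_erase.2 ⟨hj, Finset.mem_univ j⟩) (by simp)
    simp [hr, this]
  have hrdeg : r.natDegree ≤ d := by
    refine (natDegree_C_mul_le _ _).trans ?_
    rw [hq, natDegree_prod_of_monic _ _ fun j _ => monic_X_sub_C _]
    simp
  have hev : ∀ᶠ ε in 𝓝[>] (0 : ℝ), ∀ j, ∀ k : Fin d,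
      sgn ((derivative^[k + 1] h).eval (s j) - ε * (derivative^[k + 1] r).eval (s j)) =
        sgn ((derivative^[k + 1] h).eval (s j)) :=
    eventually_all.2 fun j => eventually_all.2 fun k =>
      eventually_sgn_sub_mul_eq (hne j k k.2) _
  obtain ⟨ε, hε, hpos⟩ := (hev.and self_mem_nhdsWithin).exists
  refine ⟨h - C ε * r, ?_, ?_, ?_⟩
  · exact (natDegree_sub_le _ _).trans (max_le hh ((natDegree_C_mul_le _ _).trans hrdeg))
  · have : 0 < ε * (q.eval (s i) * q.eval (s i)) :=
      mul_pos hpos (mul_self_pos.2 hqi)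
    simp only [eval_sub, eval_mul, eval_C, hr, hzero, sgn]
    rw [if_neg (by linarith), if_pos le_rfl]
    norm_num
  · intro j hj k hk
    cases k with
    | zero => simp [hrj j hj]
    | succ k =>
      rw [iterate_derivative_sub, iterate_derivative_C_mul]
      simpa using hε j ⟨k, hk⟩

/-- Inference dimension lower bound `Ω(d)`: there are a polynomial `h` of degree
exactly `d`, points `s 0 < … < s (d-1)`, and degree-≤`d` polynomials `g i`, such that
each `g i` agrees with `h` on all derivative queries (orders `0,…,d`) at every point
other than `s i`, yet disagrees with `h` on the label of `s i`. -/
theorem stmt10 (d : ℕ) (hd : 1 ≤ d) :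
    ∃ (h : Polynomial ℝ) (s : Fin d → ℝ) (g : Fin d → Polynomial ℝ),
      h.degree = (d : ℕ) ∧ StrictMono s ∧ (∀ i, (g i).natDegree ≤ d) ∧
      ∀ i : Fin d,
        sgn ((g i).eval (s i)) ≠ sgn (h.eval (s i)) ∧
        (∀ j : Fin d, j ≠ i → ∀ k ≤ d,
          sgn ((Polynomial.derivative^[k] (g i)).eval (s j)) =
            sgn ((Polynomial.derivative^[k] h).eval (s j))) := by
  obtain ⟨s, hs, hne⟩ := exists_strictMono_iterate_derivative_ne_zero d
  set h : Polynomial ℝ := ∏ i, (Polynomial.X - Polynomial.C (s i)) with hh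
  have hmonic : h.Monic :=
    Polynomial.monic_prod_of_monic _ _ fun i _ => Polynomial.monic_X_sub_C _
  have hdeg : h.natDegree = d := by
    simp [hh, Polynomial.natDegree_prod_of_monic, Polynomial.monic_X_sub_C]
  have hzero : ∀ j, h.eval (s j) = 0 := by
    intro j
    rw [hh, Polynomial.eval_prod]
    exact Finset.prod_eq_zero (Finset.mem_univ j) (by simp)
  choose g hgdeg hg using exists_perturbation hdeg.le hs.injective hzero hne
  refine ⟨h, s, g, ?_, hs, hgdeg, hg⟩
  rw [Polynomial.degree_eq_natDegree hmonic.ne_zero, hdeg]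
end

section
/- For every integer n ≥ 1, there exist distinct points u_1, …, u_n ∈ ℝ², a two-variable real polynomial h of total degree at most 2, and two-variable real polynomials h_1, …, h_n each of total degree at most 2, such that for every i ∈ {1,…,n}: (1) for every j ≠ i, sign(h_i(u_j)) = sign(h(u_j)), the signs of both first partial derivatives of h_i at u_j equal the corresponding signs for h, and the signs of all four second partial derivatives of h_i at u_j equal the corresponding signs for h; while (2) sign(h_i(u_i)) ≠ sign(h(u_i)). (In other words, the inference dimension of degree-2 bivariate polynomial threshold functions with label, gradient, and Hessian sign queries is infinite.) -/
open MvPolynomial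

theorem sgn_of_nonneg {t : ℝ} (ht : 0 ≤ t) : sgn t = 1 := if_pos ht

theorem sgn_of_neg {t : ℝ} (ht : t < 0) : sgn t = -1 := if_neg (not_le.mpr ht)

/-- The affine polynomial `y + 2 c x + (c ^ 2 - 1 / 2)`, which at the point `(-d, d ^ 2)` of the
parabola `y = x ^ 2` takes the value `(d - c) ^ 2 - 1 / 2`. -/
noncomputable def shiftedTangent (c : ℝ) : MvPolynomial (Fin 2) ℝ :=
  X 1 + C (2 * c) * X 0 + C (c ^ 2 - 1 / 2)

theorem totalDegree_shiftedTangent_le (c : ℝ) : (shiftedTangent c).totalDegree ≤ 2 := by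
  have hX : ∀ a : Fin 2, (X a : MvPolynomial (Fin 2) ℝ).totalDegree = 1 := totalDegree_X
  have hmul := totalDegree_mul (C (2 * c) : MvPolynomial (Fin 2) ℝ) (X 0)
  rw [totalDegree_C, hX] at hmul
  refine (totalDegree_add _ _).trans (max_le ((totalDegree_add _ _).trans (max_le ?_ ?_)) ?_)
  · rw [hX]; norm_num
  · omega
  · rw [totalDegree_C]; norm_num

theorem eval_shiftedTangent (c d : ℝ) :
    eval ![-d, d ^ 2] (shiftedTangent c) = (d - c) ^ 2 - 1 / 2 := by
  simp [shiftedTangent]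
  ring

theorem pderiv_shiftedTangent (c : ℝ) (a : Fin 2) :
    pderiv a (shiftedTangent c) = C (![2 * c, 1] a) := by
  fin_cases a <;> simp [shiftedTangent, pderiv_X]

/-- The inference dimension of degree-2 bivariate polynomial threshold functions with
label, gradient, and Hessian sign queries is infinite: for every `n` there are distinct
points `u 0, …, u (n-1)` in `ℝ²`, a bivariate polynomial `h` of total degree at most 2,
and bivariate polynomials `H i` of total degree at most 2, such that each `H i` agrees
with `h` in the sign of the value, of both first partials, and of all four second
partials at every point `u j` with `j ≠ i`, yet disagrees with `h` in sign at `u i`. -/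
theorem stmt11 (n : ℕ) (hn : 1 ≤ n) :
    ∃ (u : Fin n → (Fin 2 → ℝ)) (h : MvPolynomial (Fin 2) ℝ)
      (H : Fin n → MvPolynomial (Fin 2) ℝ),
      Function.Injective u ∧ h.totalDegree ≤ 2 ∧ (∀ i, (H i).totalDegree ≤ 2) ∧
      ∀ i : Fin n,
        (∀ j : Fin n, j ≠ i →
          sgn (eval (u j) (H i)) = sgn (eval (u j) h) ∧
          (∀ a : Fin 2,
            sgn (eval (u j) (pderiv a (H i))) = sgn (eval (u j) (pderiv a h))) ∧
          (∀ a b : Fin 2,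
            sgn (eval (u j) (pderiv a (pderiv b (H i)))) =
              sgn (eval (u j) (pderiv a (pderiv b h))))) ∧
        sgn (eval (u i) (H i)) ≠ sgn (eval (u i) h) := by
  refine ⟨fun j => ![-(j : ℝ), (j : ℝ) ^ 2], 1, fun i => shiftedTangent (i : ℝ), ?_, ?_, ?_, ?_⟩
  · intro i j hij
    have h0 := congrFun hij 0
    simpa [Fin.val_inj] using h0
  · simp
  · exact fun i => totalDegree_shiftedTangent_le _
  · intro i
    refine ⟨fun j hj => ⟨?_, fun a => ?_, fun a b => ?_⟩, ?_⟩
    · have hne : (j : ℤ) - (i : ℤ) ≠ 0 := by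
        have := Fin.val_ne_of_ne hj
        omega
      have hsq : (1 : ℤ) ≤ ((j : ℤ) - (i : ℤ)) ^ 2 := Int.add_one_le_iff.mpr (sq_pos_iff.mpr hne)
      have hsq' : (1 : ℝ) ≤ ((j : ℝ) - (i : ℝ)) ^ 2 := by exact_mod_cast hsq
      rw [eval_shiftedTangent, sgn_of_nonneg (by linarith), sgn_of_nonneg (by simp)]
    · rw [pderiv_shiftedTangent, eval_C, sgn_of_nonneg (by fin_cases a <;> simp),
        sgn_of_nonneg (by simp)]
    · rw [pderiv_shiftedTangent, pderiv_C, pderiv_one, map_zero, map_zero, map_zero]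
    · rw [eval_shiftedTangent, sgn_of_neg (by norm_num), sgn_of_nonneg (by simp)]
      norm_num
end

section
/- Let d ≥ 1 be an integer and let a, n be real numbers with 0 ≤ a ≤ d ≤ n. Then ∫_d^n ( 1 − (1 − a/x)^d ) dx ≤ d · a · ( ln n − ln d ). -/
/-- For an integer `d ≥ 1` and reals `0 ≤ a ≤ d ≤ n`:
`∫_d^n (1 − (1 − a/x)^d) dx ≤ d·a·(ln n − ln d)`. -/
theorem stmt15 (d : ℕ) (hd : 1 ≤ d) (a n : ℝ) (ha0 : 0 ≤ a) (had : a ≤ (d : ℝ))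
    (hdn : (d : ℝ) ≤ n) :
    (∫ x in (d : ℝ)..n, (1 - (1 - a / x) ^ d)) ≤
      (d : ℝ) * a * (Real.log n - Real.log d) := by
  have hd0 : (0 : ℝ) < d := by exact_mod_cast hd
  have hn0 : 0 < n := hd0.trans_le hdn
  have hne : ∀ x ∈ Set.uIcc (d : ℝ) n, x ≠ 0 := fun x hx =>
    (hd0.trans_le (Set.uIcc_of_le hdn ▸ hx).1).ne'
  have hdiv : ContinuousOn (fun x : ℝ => a / x) (Set.uIcc (d : ℝ) n) :=
    continuousOn_const.div continuousOn_id hne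
  have hinv : ContinuousOn (fun x : ℝ => (d : ℝ) * a * x⁻¹) (Set.uIcc (d : ℝ) n) :=
    continuousOn_const.mul (continuousOn_id.inv₀ hne)
  calc (∫ x in (d : ℝ)..n, (1 - (1 - a / x) ^ d))
      ≤ ∫ x in (d : ℝ)..n, (d : ℝ) * a * x⁻¹ := by
        refine intervalIntegral.integral_mono_on hdn
          (continuousOn_const.sub ((continuousOn_const.sub hdiv).pow d)).intervalIntegrable
          hinv.intervalIntegrable fun x hx => ?_
        have hx0 : 0 < x := hd0.trans_le hx.1
        have hax : a / x ≤ 1 := (div_le_one hx0).2 (had.trans hx.1)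
        have bernoulli := one_add_mul_le_pow (a := -(a / x)) (by linarith) d
        rw [← sub_eq_add_neg] at bernoulli
        have : (d : ℝ) * a * x⁻¹ = d * (a / x) := by ring
        linarith
    _ = (d : ℝ) * a * (Real.log n - Real.log d) := by
        rw [intervalIntegral.integral_const_mul, integral_inv_of_pos hd0 hn0,
          Real.log_div hn0.ne' hd0.ne']
end
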